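/- Let B be a skew brace and let S be a strong left ideal of B. Then S is ρ-invariant: ρ_b(S) = S for every b ∈ B (in addition to being λ-invariant by definition). -/

import Mathlib

/-!
Common definitions: skew braces, set-theoretic solutions of the Yang–Baxter
equation, structure skew braces, ideals, i-homomorphisms, solubility.
-/

universe u v

/-- A skew (left) brace: two group structures `(B,+)` and `(B,·)` sharing the
same identity `0`, with `a·(b+c) = a·b − a + a·c`. -/
structure SkewBrace (B : Type u) where
  add : B → B → B
  zero : B
  neg : B → B
  mul : B → B → B
  inv : B → B
  add_assoc : ∀ a b c, add (add a b) c = add a (add b c)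
  zero_add : ∀ a, add zero a = a
  add_zero : ∀ a, add a zero = a
  neg_add : ∀ a, add (neg a) a = zero
  add_neg : ∀ a, add a (neg a) = zero
  mul_assoc : ∀ a b c, mul (mul a b) c = mul a (mul b c)
  zero_mul : ∀ a, mul zero a = a
  mul_zero : ∀ a, mul a zero = a
  inv_mul : ∀ a, mul (inv a) a = zero
  mul_inv : ∀ a, mul a (inv a) = zero
  compat : ∀ a b c, mul a (add b c) = add (add (mul a b) (neg a)) (mul a c)

namespace SkewBrace

variable {B : Type u} (S : SkewBrace B)

/-- `λ_a(b) = −a + a·b`. -/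
def lam (a b : B) : B := S.add (S.neg a) (S.mul a b)

/-- `ρ_b(a) = λ_a(b)⁻¹ · a · b`. -/
def rho (b a : B) : B := S.mul (S.mul (S.inv (S.lam a b)) a) b

/-- The solution of the YBE associated with a skew brace:
`r_B(a,b) = (λ_a(b), ρ_b(a))`. -/
def rB : B × B → B × B := fun p => (S.lam p.1 p.2, S.rho p.2 p.1)

end SkewBrace

/-- Homomorphism of skew braces: preserves both operations. -/
def IsHom {B : Type u} {C : Type v} (S : SkewBrace B) (T : SkewBrace C) (f : B → C) : Prop :=
  (∀ a b, f (S.add a b) = T.add (f a) (f b)) ∧ (∀ a b, f (S.mul a b) = T.mul (f a) (f b))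

/-- The kernel of a skew brace homomorphism: preimage of `0`. -/
def brKer {B : Type u} {C : Type v} (T : SkewBrace C) (f : B → C) : Set B :=
  {a | f a = T.zero}

/-- An ideal of a skew brace: a sub-skew brace, normal in both `(B,+)` and `(B,·)`,
and `λ_b`-invariant for all `b`. -/
def IsIdeal {B : Type u} (S : SkewBrace B) (I : Set B) : Prop :=
  S.zero ∈ I ∧
  (∀ a ∈ I, ∀ b ∈ I, S.add a b ∈ I) ∧ (∀ a ∈ I, S.neg a ∈ I) ∧
  (∀ a ∈ I, ∀ b ∈ I, S.mul a b ∈ I) ∧ (∀ a ∈ I, S.inv a ∈ I) ∧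
  (∀ b : B, ∀ a ∈ I, S.add (S.add b a) (S.neg b) ∈ I) ∧
  (∀ b : B, ∀ a ∈ I, S.mul (S.mul b a) (S.inv b) ∈ I) ∧
  (∀ b : B, S.lam b '' I = I)

/-- A skew brace is simple if it is non-trivial and its only ideals are `{0}` and `B`. -/
def IsSimpleBrace {B : Type u} (S : SkewBrace B) : Prop :=
  (∃ a : B, a ≠ S.zero) ∧
  ∀ I : Set B, IsIdeal S I → I = {S.zero} ∨ I = Set.univ

/-- The socle of a skew brace: elements `a` with `λ_a = id` commuting additively
with everything. -/
def Soc {B : Type u} (S : SkewBrace B) : Set B :=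
  {a | (∀ b, S.lam a b = b) ∧ (∀ b, S.add a b = S.add b a)}

/-- `r × id` on triples. -/
def rOne {X : Type u} (r : X × X → X × X) : X × X × X → X × X × X :=
  fun p => ((r (p.1, p.2.1)).1, (r (p.1, p.2.1)).2, p.2.2)

/-- `id × r` on triples. -/
def rTwo {X : Type u} (r : X × X → X × X) : X × X × X → X × X × X :=
  fun p => (p.1, r p.2)

/-- `(X,r)` is a set-theoretic solution of the Yang–Baxter equation. -/
def IsSolution {X : Type u} (r : X × X → X × X) : Prop :=
  Function.Bijective r ∧
  rOne r ∘ rTwo r ∘ rOne r = rTwo r ∘ rOne r ∘ rTwo r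

/-- `λ_x(y)` for a solution, i.e. the first component of `r(x,y)`. -/
def lamMap {X : Type u} (r : X × X → X × X) (x : X) : X → X := fun y => (r (x, y)).1

/-- `ρ_y(x)` for a solution, i.e. the second component of `r(x,y)`. -/
def rhoMap {X : Type u} (r : X × X → X × X) (y : X) : X → X := fun x => (r (x, y)).2

/-- Non-degeneracy: all `λ_x` and `ρ_y` are bijective. -/
def Nondeg {X : Type u} (r : X × X → X × X) : Prop :=
  (∀ x, Function.Bijective (lamMap r x)) ∧ (∀ y, Function.Bijective (rhoMap r y))

/-- Homomorphism of solutions: `(f×f)∘r = s∘(f×f)`. -/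
def IsSolHom {X : Type u} {Y : Type v} (r : X × X → X × X) (s : Y × Y → Y × Y)
    (f : X → Y) : Prop :=
  Prod.map f f ∘ r = s ∘ Prod.map f f

/-- The structure skew brace `(G_X, ι)` of a solution `(X,r)`: the image of `ι`
generates `(G_X,·)`, `ι` intertwines `r` with `r_{G_X}`, and the pair has the
universal property for maps into skew braces. -/
structure StructureBrace {X : Type u} (r : X × X → X × X) where
  G : Type u
  S : SkewBrace G
  ι : X → G
  gen : ∀ H : Set G, S.zero ∈ H → (∀ a ∈ H, ∀ b ∈ H, S.mul a b ∈ H) →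
      (∀ a ∈ H, S.inv a ∈ H) → Set.range ι ⊆ H → H = Set.univ
  compat : Prod.map ι ι ∘ r = S.rB ∘ Prod.map ι ι
  univ : ∀ {C : Type u} (T : SkewBrace C) (g : X → C),
      Prod.map g g ∘ r = T.rB ∘ Prod.map g g →
      ∃! h : G → C, IsHom S T h ∧ h ∘ ι = g

/-- The multiplicative subgroup (as a set) generated by a subset. -/
def mulClosure {B : Type u} (S : SkewBrace B) (A : Set B) : Set B :=
  ⋂₀ {H : Set B | S.zero ∈ H ∧ (∀ a ∈ H, ∀ b ∈ H, S.mul a b ∈ H) ∧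
      (∀ a ∈ H, S.inv a ∈ H) ∧ A ⊆ H}

/-- The additive subgroup (as a set) generated by a subset. -/
def addClosure {B : Type u} (S : SkewBrace B) (A : Set B) : Set B :=
  ⋂₀ {H : Set B | S.zero ∈ H ∧ (∀ a ∈ H, ∀ b ∈ H, S.add a b ∈ H) ∧
      (∀ a ∈ H, S.neg a ∈ H) ∧ A ⊆ H}

/-- The ideal generated by a subset: intersection of all ideals containing it. -/
def idealClosure {B : Type u} (S : SkewBrace B) (A : Set B) : Set B :=
  ⋂₀ {I : Set B | IsIdeal S I ∧ A ⊆ I}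

/-- Product of two subsets in the multiplicative group. -/
def setMul {B : Type u} (S : SkewBrace B) (A₁ A₂ : Set B) : Set B :=
  {c | ∃ a ∈ A₁, ∃ b ∈ A₂, c = S.mul a b}

/-- Sum of two subsets in the additive group. -/
def setAdd {B : Type u} (S : SkewBrace B) (A₁ A₂ : Set B) : Set B :=
  {c | ∃ a ∈ A₁, ∃ b ∈ A₂, c = S.add a b}

/-- The multiplicative left coset `a·I`. -/
def lCoset {B : Type u} (S : SkewBrace B) (a : B) (I : Set B) : Set B :=
  (fun w => S.mul a w) '' I

/-- Equivalence class of the kernel relation of a map. -/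
def kerClass {X : Type u} {Y : Type v} (f : X → Y) (x : X) : Set X := {z | f z = f x}

/-- `X₀` is an i-kernel of the homomorphism of solutions `f : (X,r) → (Y,s)`:
`f` is a homomorphism of solutions, `X₀` is an equivalence class of `ker f`, and
for every class `Z` of `ker f`, `r(X₀ × Z) = Z × X₀` and `r(Z × X₀) = X₀ × Z`.
A homomorphism admitting such a class is an i-homomorphism. -/
def IsIKernel {X : Type u} {Y : Type v} (r : X × X → X × X) (s : Y × Y → Y × Y)
    (f : X → Y) (X₀ : Set X) : Prop :=
  IsSolHom r s f ∧ (∃ x : X, X₀ = kerClass f x) ∧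
  ∀ z : X, r '' (X₀ ×ˢ kerClass f z) = (kerClass f z) ×ˢ X₀ ∧
           r '' ((kerClass f z) ×ˢ X₀) = X₀ ×ˢ (kerClass f z)

/-- A strong left ideal: a `λ`-invariant subgroup of `(B,+)` which is normal
in `(B,+)`. -/
def IsStrongLeftIdeal {B : Type u} (S : SkewBrace B) (I : Set B) : Prop :=
  S.zero ∈ I ∧ (∀ a ∈ I, ∀ b ∈ I, S.add a b ∈ I) ∧ (∀ a ∈ I, S.neg a ∈ I) ∧
  (∀ b : B, S.lam b '' I = I) ∧
  (∀ b : B, ∀ a ∈ I, S.add (S.add b a) (S.neg b) ∈ I)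

/-- An abelian ideal: an ideal on which the two operations coincide and are
commutative (so it is an abelian/trivial skew brace). -/
def IsAbelianIdeal {C : Type u} (T : SkewBrace C) (J : Set C) : Prop :=
  IsIdeal T J ∧ ∀ a ∈ J, ∀ b ∈ J, T.mul a b = T.add a b ∧ T.add a b = T.add b a

/-- Solubility of a skew brace: epimorphisms `f_k : B → B_k`, `0 ≤ k ≤ t`, with
`Ker f_t = 0 ⊆ … ⊆ Ker f_0 = B` and `f_k(Ker f_{k−1})` an abelian ideal of `B_k`. -/
def IsSoluble {B : Type u} (S : SkewBrace B) : Prop :=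
  ∃ (t : ℕ) (C : Fin (t + 1) → Type u) (T : ∀ k, SkewBrace (C k)) (f : ∀ k, B → C k),
    (∀ k, IsHom S (T k) (f k) ∧ Function.Surjective (f k)) ∧
    brKer (T (Fin.last t)) (f (Fin.last t)) = {S.zero} ∧
    brKer (T 0) (f 0) = Set.univ ∧
    (∀ k : Fin t, brKer (T k.succ) (f k.succ) ⊆ brKer (T k.castSucc) (f k.castSucc)) ∧
    (∀ k : Fin t, IsAbelianIdeal (T k.succ) (f k.succ '' brKer (T k.castSucc) (f k.castSucc)))

/-- Solubility of a solution `(X,r)` (with structure skew brace `(G_X, ι)`):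
there are skew braces `B_0,…,B_t`, i-epimorphisms `f_k : (X,r) → (B_k, r_{B_k})`
with i-kernels `X_k` for `0 ≤ k ≤ t−1`, and an epimorphism `f_t`, such that
`ker f_k ⊆ ker f_{k−1}`, `ker f_0` is total, `ker f_t ⊆ ker ι`, and each
`f_k(X_{k−1})` lies in an abelian ideal `J` of `B_k` with `f_k(x)·J = f_k(y)·J`
whenever `x (ker f_{k−1}) y`. -/
def IsSolubleSolution {X : Type u} (r : X × X → X × X) (GX : StructureBrace r) : Prop :=
  ∃ (t : ℕ) (C : Fin (t + 1) → Type u) (T : ∀ k, SkewBrace (C k))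
    (f : ∀ k : Fin (t + 1), X → C k) (Xk : Fin t → Set X),
    (∀ k : Fin (t + 1), IsSolHom r (T k).rB (f k) ∧ Function.Surjective (f k)) ∧
    (∀ k : Fin t, IsIKernel r (T k.castSucc).rB (f k.castSucc) (Xk k)) ∧
    (∀ x y : X, f 0 x = f 0 y) ∧
    (∀ k : Fin t, ∀ x y : X, f k.succ x = f k.succ y → f k.castSucc x = f k.castSucc y) ∧
    (∀ x y : X, f (Fin.last t) x = f (Fin.last t) y → GX.ι x = GX.ι y) ∧
    (∀ k : Fin t, ∃ J : Set (C k.succ), IsAbelianIdeal (T k.succ) J ∧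
      f k.succ '' (Xk k) ⊆ J ∧
      ∀ x y : X, f k.castSucc x = f k.castSucc y →
        lCoset (T k.succ) (f k.succ x) J = lCoset (T k.succ) (f k.succ y) J)

/-- Decomposability of a solution: `X = Y ∪ Z` with `Y, Z` proper and
`r(Y×Y) = Y×Y`, `r(Z×Z) = Z×Z`. -/
def Decomposable {X : Type u} (r : X × X → X × X) : Prop :=
  ∃ Y Z : Set X, Y ≠ Set.univ ∧ Z ≠ Set.univ ∧ Y ∪ Z = Set.univ ∧
    r '' (Y ×ˢ Y) = Y ×ˢ Y ∧ r '' (Z ×ˢ Z) = Z ×ˢ Z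

section Identities

variable {A : Type u} [AddGroup A] [Group A]

theorem one_eq_zero_of_compat (h : ∀ a b c : A, a * (b + c) = a * b + -a + a * c) :
    (1 : A) = 0 := by
  simpa using h 1 0 0

theorem mul_neg_of_compat (h : ∀ a b c : A, a * (b + c) = a * b + -a + a * c) (x a : A) :
    x * -a = x + -(x * a) + x := by
  have h₁ := h x a (-a)
  rw [add_neg_cancel, ← one_eq_zero_of_compat h, mul_one, add_assoc] at h₁
  rw [add_assoc, neg_add_eq_of_eq_add h₁, add_neg_cancel_left]

theorem inv_lam_mul_mul_of_compat (h : ∀ a b c : A, a * (b + c) = a * b + -a + a * c)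
    (a b : A) : (-a + a * b)⁻¹ * a * b = (b⁻¹ * a⁻¹ + -b⁻¹)⁻¹ := by
  rw [← inv_inj, inv_inv]
  have h₁ := h (b⁻¹ * a⁻¹) (-a) (a * b)
  rw [mul_neg_of_compat h] at h₁
  have h₂ : b⁻¹ * a⁻¹ * (a * b) = 0 := by
    rw [← one_eq_zero_of_compat h]; group
  rw [h₂] at h₁
  simp only [mul_inv_rev, inv_inv]
  rw [← mul_assoc, h₁]
  simp [add_assoc]

theorem rho_rho_inv_of_compat (h : ∀ a b c : A, a * (b + c) = a * b + -a + a * c)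
    (b r : A) : b⁻¹ * (b * r⁻¹ + -b) + -b⁻¹ = r⁻¹ := by
  rw [h, mul_neg_of_compat h, inv_mul_cancel, one_eq_zero_of_compat h]
  simp

end Identities

namespace SkewBrace

variable {B : Type u} (S : SkewBrace B)

/-- The additive group of a skew brace. -/
abbrev toAddGroup : AddGroup B where
  add := S.add
  zero := S.zero
  neg := S.neg
  add_assoc := S.add_assoc
  zero_add := S.zero_add
  add_zero := S.add_zero
  neg_add_cancel := S.neg_add
  nsmul := @nsmulRec B ⟨S.zero⟩ ⟨S.add⟩
  zsmul := @zsmulRec B ⟨S.zero⟩ ⟨S.add⟩ ⟨S.neg⟩ (@nsmulRec B ⟨S.zero⟩ ⟨S.add⟩)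

/-- The multiplicative group of a skew brace. -/
abbrev toGroup : Group B where
  mul := S.mul
  one := S.zero
  inv := S.inv
  mul_assoc := S.mul_assoc
  one_mul := S.zero_mul
  mul_one := S.mul_zero
  inv_mul_cancel := S.inv_mul
  npow := @npowRec B ⟨S.zero⟩ ⟨S.mul⟩
  zpow := @zpowRec B ⟨S.zero⟩ ⟨S.mul⟩ ⟨S.inv⟩ (@npowRec B ⟨S.zero⟩ ⟨S.mul⟩)

theorem rho_eq (b a : B) :
    S.rho b a = S.inv (S.add (S.mul (S.inv b) (S.inv a)) (S.neg (S.inv b))) :=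
  let := S.toAddGroup
  let := S.toGroup
  inv_lam_mul_mul_of_compat S.compat a b

theorem inv_inv (a : B) : S.inv (S.inv a) = a :=
  let := S.toGroup
  _root_.inv_inv a

theorem rho_rho_inv (b r : B) : S.rho b (S.rho (S.inv b) r) = r := by
  let := S.toAddGroup
  let := S.toGroup
  rw [rho_eq, rho_eq S (S.inv b), inv_inv, inv_inv]
  exact (congrArg S.inv (rho_rho_inv_of_compat S.compat b r)).trans (S.inv_inv r)

/-- `λ_u(ρ_b(a))` is the additive conjugate `-u + a + u`, where `u = λ_a(b)`. -/
theorem lam_lam_rho (b a : B) :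
    S.lam (S.lam a b) (S.rho b a) = S.add (S.add (S.neg (S.lam a b)) a) (S.lam a b) := by
  let := S.toAddGroup
  let := S.toGroup
  change -(-a + a * b) + (-a + a * b) * ((-a + a * b)⁻¹ * a * b) =
    -(-a + a * b) + a + (-a + a * b)
  rw [_root_.mul_assoc, mul_inv_cancel_left]
  simp [_root_.add_assoc]

theorem lam_injective (a : B) : Function.Injective (S.lam a) := by
  let := S.toAddGroup
  let := S.toGroup
  intro x y hxy
  exact mul_left_cancel (add_left_cancel (hxy : -a + a * x = -a + a * y))

theorem neg_neg (a : B) : S.neg (S.neg a) = a :=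
  let := S.toAddGroup
  _root_.neg_neg a

end SkewBrace

theorem IsStrongLeftIdeal.rho_mem {B : Type u} {S : SkewBrace B} {I : Set B}
    (hI : IsStrongLeftIdeal S I) (b : B) {a : B} (ha : a ∈ I) : S.rho b a ∈ I := by
  obtain ⟨-, -, -, hlam, hconj⟩ := hI
  have h := hconj (S.neg (S.lam a b)) a ha
  rw [S.neg_neg, ← S.lam_lam_rho, ← hlam (S.lam a b)] at h
  exact (S.lam_injective _).mem_set_image.mp h

/-- Every strong left ideal of a skew brace is `ρ`-invariant. -/
theorem stmt_8 {B : Type u} (S : SkewBrace B) (I : Set B)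
    (hI : IsStrongLeftIdeal S I) :
    ∀ b : B, S.rho b '' I = I := by
  intro b
  refine Set.Subset.antisymm (Set.image_subset_iff.mpr fun a ha => hI.rho_mem b ha) fun r hr => ?_
  exact ⟨S.rho (S.inv b) r, hI.rho_mem _ hr, S.rho_rho_inv b r⟩
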